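/- Let k be a positive integer and let H be a divisible group (for every h ∈ H and every positive integer n there exists x ∈ H with xⁿ = h) in which every γ_k-value has a finite right Engel sink. Then for all g, x ∈ H there is a positive integer N = N(x,g) such that [[g, ₍ₖ₋₁₎x], ₙx] commutes with [g, ₍ₖ₋₁₎x] for all n ≥ N, i.e., [[[g, ₍ₖ₋₁₎x], ₙx], [g, ₍ₖ₋₁₎x]] = 1 for all n ≥ N. -/

import Mathlib

/-- The commutator `[a,b] = a⁻¹ * b⁻¹ * a * b`. -/
def pcomm {G : Type*} [Group G] (a b : G) : G := a⁻¹ * b⁻¹ * a * b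

/-- The iterated Engel commutator `[g, ₙx]`, with `[g, ₀x] = g` and
`[g, ₙ₊₁x] = [[g, ₙx], x]`. -/
def engelComm {G : Type*} [Group G] (g x : G) : ℕ → G
  | 0 => g
  | n + 1 => pcomm (engelComm g x n) x

/-- `R` is a right Engel sink of `g`: for every `x` there is a positive integer `r`
such that `[g, ₙx] ∈ R` for all `n ≥ r`. -/
def IsRightEngelSink {G : Type*} [Group G] (g : G) (R : Set G) : Prop :=
  ∀ x : G, ∃ r : ℕ, 0 < r ∧ ∀ n : ℕ, r ≤ n → engelComm g x n ∈ R

/-- `R` is the smallest right Engel sink of `g`. -/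
def IsMinRightEngelSink {G : Type*} [Group G] (g : G) (R : Set G) : Prop :=
  IsRightEngelSink g R ∧ ∀ S : Set G, IsRightEngelSink g S → R ⊆ S

/-- The left-normed commutator `[g, x₁, x₂, …]` of `g` against a list. -/
def commFold {G : Type*} [Group G] (g : G) : List G → G
  | [] => g
  | x :: xs => commFold (pcomm g x) xs

/-- The left-normed commutator `[g₁, g₂, …, g_k]` of the entries of a list
(`1` for the empty list). -/
def commList {G : Type*} [Group G] : List G → G
  | [] => 1
  | x :: xs => commFold x xs

/-- `g` is a `γ_k`-value: a left-normed commutator `[g₁, …, g_k]` of `k` elements. -/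
def IsGammaValue {G : Type*} [Group G] (k : ℕ) (g : G) : Prop :=
  ∃ x : Fin k → G, g = commList (List.ofFn x)

/-- A group is locally nilpotent if every finitely generated subgroup is nilpotent. -/
def IsLocallyNilpotent (G : Type*) [Group G] : Prop :=
  ∀ S : Finset G, Group.IsNilpotent (Subgroup.closure (S : Set G))

theorem commFold_replicate {G : Type*} [Group G] (x : G) (m : ℕ) (g : G) :
    commFold g (List.replicate m x) = engelComm g x m := by
  have shift : ∀ (n : ℕ) (a : G), engelComm (pcomm a x) x n = engelComm a x (n + 1) := by
    intro n
    induction n with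
    | zero => intro a; rfl
    | succ n ih => intro a; rw [engelComm, ih, ← engelComm]
  induction m generalizing g with
  | zero => rfl
  | succ m ih => rw [List.replicate_succ, commFold, ih, shift]

theorem isGammaValue_engelComm {G : Type*} [Group G] (g x : G) (m : ℕ) :
    IsGammaValue (m + 1) (engelComm g x m) := by
  refine ⟨Fin.cons g fun _ => x, ?_⟩
  simp [List.ofFn_succ, List.ofFn_const, commList, commFold_replicate]

theorem map_engelComm {G K : Type*} [Group G] [Group K] (f : G →* K) (g x : G) (n : ℕ) :
    f (engelComm g x n) = engelComm (f g) (f x) n := by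
  induction n with
  | zero => rfl
  | succ n ih => simp [engelComm, pcomm, ih]

/-- The values taken infinitely often by some sequence `n ↦ [g, ₙx]`. -/
def recurrentEngelValues {G : Type*} [Group G] (g : G) : Set G :=
  {z | ∃ x : G, ∃ᶠ n in Filter.atTop, engelComm g x n = z}

theorem recurrentEngelValues_subset {G : Type*} [Group G] {g : G} {R : Set G}
    (hR : IsRightEngelSink g R) : recurrentEngelValues g ⊆ R := by
  rintro z ⟨x, hz⟩
  obtain ⟨r, -, hr⟩ := hR x
  obtain ⟨n, rfl, hn⟩ := (hz.and_eventually (Filter.eventually_ge_atTop r)).exists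
  exact hr n hn

theorem eventually_mem_recurrentEngelValues {G : Type*} [Group G] {g : G} {R : Set G}
    (hfin : R.Finite) (hR : IsRightEngelSink g R) (x : G) :
    ∀ᶠ n in Filter.atTop, engelComm g x n ∈ recurrentEngelValues g := by
  obtain ⟨r, -, hr⟩ := hR x
  have avoid : ∀ᶠ n in Filter.atTop, ∀ z ∈ R \ recurrentEngelValues g, engelComm g x n ≠ z :=
    (Filter.eventually_all_finite hfin.sdiff).2 fun z hz =>
      Filter.not_frequently.1 fun hf => hz.2 ⟨x, hf⟩
  filter_upwards [avoid, Filter.eventually_ge_atTop r] with n hn hrn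
  by_contra hmem
  exact hn _ ⟨hr n hrn, hmem⟩ rfl

theorem conj_mem_recurrentEngelValues {G : Type*} [Group G] {g y z : G} (hy : Commute y g)
    (hz : z ∈ recurrentEngelValues g) : MulAut.conj y z ∈ recurrentEngelValues g := by
  obtain ⟨x, hx⟩ := hz
  refine ⟨MulAut.conj y x, hx.mono ?_⟩
  rintro n rfl
  have hg : MulAut.conj y g = g := by simp [hy.eq]
  have := map_engelComm (MulAut.conj y).toMonoidHom g x n
  simp only [MulEquiv.toMonoidHom_eq_coe, MonoidHom.coe_coe, hg] at this
  exact this.symm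

/-- An element of a divisible group with finitely many recurrent Engel values centralizes
them: they are permuted under conjugation by every root of the element. -/
theorem commute_of_mem_recurrentEngelValues {G : Type*} [Group G]
    (hdiv : ∀ g : G, ∀ n : ℕ, 0 < n → ∃ y : G, y ^ n = g) {g z : G}
    (hfin : (recurrentEngelValues g).Finite) (hz : z ∈ recurrentEngelValues g) :
    Commute g z := by
  have : Finite (recurrentEngelValues g) := hfin
  obtain ⟨y, hy⟩ := hdiv g (Nat.card (Equiv.Perm (recurrentEngelValues g))) Nat.card_pos
  have hyg : Commute y g := hy ▸ Commute.self_pow y _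
  have hiff : ∀ w, MulAut.conj y w ∈ recurrentEngelValues g ↔ w ∈ recurrentEngelValues g := by
    refine fun w => ⟨fun hw => ?_, conj_mem_recurrentEngelValues hyg⟩
    simpa [mul_assoc] using conj_mem_recurrentEngelValues hyg.inv_left hw
  let σ : Equiv.Perm (recurrentEngelValues g) :=
    Equiv.Perm.subtypePerm (MulAut.conj y).toEquiv hiff
  have iterate : ∀ n : ℕ, (((σ ^ n) ⟨z, hz⟩ : recurrentEngelValues g) : G)
      = MulAut.conj (y ^ n) z := by
    intro n
    induction n with
    | zero => simp
    | succ n ih =>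
      rw [pow_succ', Equiv.Perm.mul_apply, pow_succ', map_mul, MulAut.mul_apply, ← ih]
      rfl
  have fixed := iterate (Nat.card (Equiv.Perm (recurrentEngelValues g)))
  rw [pow_card_eq_one', hy, Equiv.Perm.one_apply, MulAut.conj_apply] at fixed
  exact (eq_mul_inv_iff_mul_eq.1 fixed).symm

/-- **Lemma 5.1.** Let `H` be a divisible group in which every `γ_k`-value has a finite
right Engel sink. Then for all `g, x ∈ H` there is `N` such that
`[[[g, ₖ₋₁x], ₙx], [g, ₖ₋₁x]] = 1` for all `n ≥ N`. -/
theorem divisible_commutator_eventually_commutes (k : ℕ) (hk : 0 < k)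
    (H : Type*) [Group H]
    (hdiv : ∀ h : H, ∀ n : ℕ, 0 < n → ∃ x : H, x ^ n = h)
    (h : ∀ g : H, IsGammaValue k g →
      ∃ R : Set H, R.Finite ∧ IsRightEngelSink g R) :
    ∀ g x : H, ∃ N : ℕ, 0 < N ∧ ∀ n : ℕ, N ≤ n →
      pcomm (engelComm (engelComm g x (k - 1)) x n) (engelComm g x (k - 1)) = 1 := by
  intro g x
  obtain ⟨m, rfl⟩ := Nat.exists_eq_succ_of_ne_zero hk.ne'
  simp only [Nat.succ_eq_add_one, Nat.add_sub_cancel]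
  obtain ⟨R, hfin, hR⟩ := h _ (isGammaValue_engelComm g x m)
  obtain ⟨N, hN⟩ := Filter.eventually_atTop.1 (eventually_mem_recurrentEngelValues hfin hR x)
  refine ⟨N + 1, N.succ_pos, fun n hn => ?_⟩
  have hcomm := commute_of_mem_recurrentEngelValues hdiv
    (hfin.subset (recurrentEngelValues_subset hR)) (hN n (by omega))
  rw [pcomm, mul_assoc, ← hcomm.eq]
  group
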